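/- Let 𝒳ˢ_n be the uniform probability measure on the unit sphere of ℝⁿ (the spherical spike prior). For every λ with 0 ≤ λ < 1, the sequence of spiked Gaussian Wigner measures GWig_n(λ, 𝒳ˢ) is contiguous to the unspiked sequence GWig_n(0). -/

import Mathlib

open MeasureTheory Filter Topology ProbabilityTheory
open scoped ENNReal NNReal

/-- A sequence of probability measures `P n` is contiguous to `Q n` if for every
sequence of measurable events `A n`, `Q n (A n) → 0` implies `P n (A n) → 0`. -/
def Contiguous {Ω : ℕ → Type*} [∀ n, MeasurableSpace (Ω n)]
    (P Q : (n : ℕ) → Measure (Ω n)) : Prop :=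
  ∀ A : (n : ℕ) → Set (Ω n), (∀ n, MeasurableSet (A n)) →
    Tendsto (fun n => Q n (A n)) atTop (𝓝 0) →
    Tendsto (fun n => P n (A n)) atTop (𝓝 0)

/-- The unspiked Gaussian Wigner measure `GWig_n(0)`. -/
noncomputable def gwigUnspiked (n : ℕ) : Measure (Fin n → Fin n → ℝ) :=
  (Measure.pi fun _ : Fin n × Fin n => gaussianReal 0 (1 / (2 * (n : ℝ≥0)))).map
    fun W i j => W (i, j) + W (j, i)

/-- The spiked Gaussian Wigner measure `GWig_n(λ, 𝒳)`: mixture over `x ~ 𝒳` of the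
pushforward of `GWig_n(0)` under `Y ↦ λ x xᵀ + Y`. -/
noncomputable def gwigSpiked (n : ℕ) (lam : ℝ) (prior : Measure (Fin n → ℝ)) :
    Measure (Fin n → Fin n → ℝ) :=
  prior.bind fun x => (gwigUnspiked n).map fun Y i j => lam * (x i * x j) + Y i j

/-- The spherical prior: the uniform probability measure on the unit sphere of `ℝⁿ`,
realized as the law of `g / ‖g‖` for a standard Gaussian vector `g`. -/
noncomputable def sphericalPrior (n : ℕ) : Measure (Fin n → ℝ) :=
  (Measure.pi fun _ : Fin n => gaussianReal 0 1).map
    fun g => (Real.sqrt (∑ i, (g i) ^ 2))⁻¹ • g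

theorem lintegral_pi_prod_eq_prod {ι : Type*} [Fintype ι] (μ : ι → Measure ℝ)
    [∀ i, IsProbabilityMeasure (μ i)] (f : ι → ℝ → ℝ≥0∞) (hf : ∀ i, Measurable (f i)) :
    ∫⁻ x, ∏ i, f i (x i) ∂Measure.pi μ = ∏ i, ∫⁻ t, f i t ∂μ i := by
  refine (lintegral_prod_eq_prod_lintegral_of_indepFun Finset.univ
    (fun i (x : ι → ℝ) => f i (x i)) (iIndepFun_pi fun i => (hf i).aemeasurable)
    fun i => by fun_prop).trans ?_
  refine Finset.prod_congr rfl fun i _ => ?_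
  exact (measurePreserving_eval μ i).lintegral_comp (hf i)

theorem lintegral_exp_mul_gaussianReal (v : ℝ≥0) (s : ℝ) :
    ∫⁻ x, ENNReal.ofReal (Real.exp (s * x)) ∂gaussianReal 0 v
      = ENNReal.ofReal (Real.exp (v * s ^ 2 / 2)) := by
  rw [← ofReal_integral_eq_lintegral_ofReal (integrable_exp_mul_gaussianReal s)
    (ae_of_all _ fun _ => (Real.exp_pos _).le)]
  have h := congrFun (mgf_fun_id_gaussianReal (μ := 0) (v := v)) s
  simp only [mgf, zero_mul, zero_add] at h
  rw [h]

theorem lintegral_exp_sum_mul_pi_gaussianReal {ι : Type*} [Fintype ι] (v : ℝ≥0) (s : ι → ℝ) :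
    ∫⁻ x, ENNReal.ofReal (Real.exp (∑ i, s i * x i)) ∂Measure.pi (fun _ : ι => gaussianReal 0 v)
      = ENNReal.ofReal (Real.exp (v * (∑ i, s i ^ 2) / 2)) := by
  simp_rw [Real.exp_sum, ENNReal.ofReal_prod_of_nonneg fun i _ => (Real.exp_pos _).le]
  rw [lintegral_pi_prod_eq_prod (fun _ => gaussianReal 0 v)
    (fun i t => ENNReal.ofReal (Real.exp (s i * t))) fun i => by fun_prop]
  simp_rw [lintegral_exp_mul_gaussianReal]
  rw [← ENNReal.ofReal_prod_of_nonneg fun i _ => (Real.exp_pos _).le, ← Real.exp_sum,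
    Finset.mul_sum, Finset.sum_div]

theorem gaussianReal_eq_withDensity_zero {v : ℝ≥0} (hv : v ≠ 0) (a : ℝ) :
    gaussianReal a v = (gaussianReal 0 v).withDensity
      fun x => ENNReal.ofReal (Real.exp ((a * x - a ^ 2 / 2) / v)) := by
  rw [gaussianReal_of_var_ne_zero _ hv, gaussianReal_of_var_ne_zero _ hv,
    ← withDensity_mul _ (measurable_gaussianPDF 0 v) (by fun_prop)]
  congr 1
  ext x
  have hv' : (v : ℝ) ≠ 0 := by exact_mod_cast hv
  rw [Pi.mul_apply, gaussianPDF, gaussianPDF,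
    ← ENNReal.ofReal_mul (gaussianPDFReal_nonneg _ _ _), gaussianPDFReal, gaussianPDFReal,
    mul_assoc _ (Real.exp _), ← Real.exp_add]
  congr 3
  field_simp
  ring

/-- The likelihood ratio of the shift by `a` of a centered Gaussian vector with i.i.d. coordinates
of variance `v`. -/
noncomputable def shiftDensity {ι : Type*} [Fintype ι] (v : ℝ≥0) (a x : ι → ℝ) : ℝ≥0∞ :=
  ENNReal.ofReal (Real.exp ((∑ i, (a i * x i - a i ^ 2 / 2)) / v))

theorem map_add_pi_gaussianReal {ι : Type*} [Fintype ι] {v : ℝ≥0} (hv : v ≠ 0) (a : ι → ℝ) :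
    (Measure.pi fun _ : ι => gaussianReal 0 v).map (fun x i => x i + a i)
      = (Measure.pi fun _ : ι => gaussianReal 0 v).withDensity (shiftDensity v a) := by
  rw [Measure.pi_map_pi (f := fun i t => t + a i) (fun i => by fun_prop)]
  simp_rw [gaussianReal_map_add_const, zero_add]
  refine Measure.pi_eq fun s hs => ?_
  rw [withDensity_apply _ (.univ_pi hs), ← lintegral_indicator (.univ_pi hs)]
  have h : ∀ x : ι → ℝ, (Set.univ.pi s).indicator (shiftDensity v a) x
      = ∏ i, (s i).indicator
          (fun t => ENNReal.ofReal (Real.exp ((a i * t - a i ^ 2 / 2) / v))) (x i) := by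
    intro x
    by_cases hx : x ∈ Set.univ.pi s
    · rw [Set.indicator_of_mem hx, shiftDensity, Finset.sum_div, Real.exp_sum,
        ENNReal.ofReal_prod_of_nonneg fun i _ => (Real.exp_pos _).le]
      exact Finset.prod_congr rfl fun i _ => (Set.indicator_of_mem (hx i trivial)
        fun t => ENNReal.ofReal (Real.exp ((a i * t - a i ^ 2 / 2) / v))).symm
    · rw [Set.indicator_of_notMem hx]
      obtain ⟨i, hi⟩ : ∃ i, x i ∉ s i := by simpa using hx
      exact (Finset.prod_eq_zero (Finset.mem_univ i) (Set.indicator_of_notMem hi _)).symm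
  simp_rw [h]
  rw [lintegral_pi_prod_eq_prod (fun _ => gaussianReal 0 v) (fun i => (s i).indicator
    (fun t => ENNReal.ofReal (Real.exp ((a i * t - a i ^ 2 / 2) / v))))
    fun i => Measurable.indicator (by fun_prop) (hs i)]
  refine Finset.prod_congr rfl fun i _ => ?_
  rw [gaussianReal_eq_withDensity_zero hv (a i), withDensity_apply _ (hs i),
    lintegral_indicator (hs i)]

theorem lintegral_shiftDensity_mul {ι : Type*} [Fintype ι] {v : ℝ≥0} (hv : v ≠ 0)
    (a b : ι → ℝ) :
    ∫⁻ x, shiftDensity v a x * shiftDensity v b x ∂Measure.pi (fun _ : ι => gaussianReal 0 v)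
      = ENNReal.ofReal (Real.exp ((∑ i, a i * b i) / v)) := by
  have hv' : (v : ℝ) ≠ 0 := by exact_mod_cast hv
  have h : ∀ x : ι → ℝ, shiftDensity v a x * shiftDensity v b x
      = ENNReal.ofReal (Real.exp (-(∑ i, (a i ^ 2 + b i ^ 2) / 2) / v))
        * ENNReal.ofReal (Real.exp (∑ i, ((a i + b i) / v) * x i)) := by
    intro x
    rw [shiftDensity, shiftDensity, ← ENNReal.ofReal_mul (Real.exp_pos _).le,
      ← ENNReal.ofReal_mul (Real.exp_pos _).le, ← Real.exp_add, ← Real.exp_add]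
    congr 2
    rw [← add_div, ← Finset.sum_add_distrib, neg_div, ← sub_eq_neg_add, Finset.sum_div,
      Finset.sum_div, ← Finset.sum_sub_distrib]
    refine Finset.sum_congr rfl fun i _ => ?_
    ring
  simp_rw [h]
  rw [lintegral_const_mul _ (by fun_prop), lintegral_exp_sum_mul_pi_gaussianReal,
    ← ENNReal.ofReal_mul (Real.exp_pos _).le, ← Real.exp_add]
  congr 2
  rw [Finset.mul_sum, Finset.sum_div, Finset.sum_div, neg_div, ← sub_eq_neg_add, Finset.sum_div,
    ← Finset.sum_sub_distrib]
  refine Finset.sum_congr rfl fun i _ => ?_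
  field_simp
  ring

theorem lintegral_exp_sq_gaussianReal_lt_top {c : ℝ} (hc : c < 1 / 2) :
    ∫⁻ z, ENNReal.ofReal (Real.exp (c * z ^ 2)) ∂gaussianReal 0 1 < ∞ := by
  rw [gaussianReal_of_var_ne_zero _ one_ne_zero,
    lintegral_withDensity_eq_lintegral_mul _ (measurable_gaussianPDF 0 1) (by fun_prop)]
  have h := (integrable_exp_neg_mul_sq (sub_pos.2 hc)).const_mul (Real.sqrt (2 * Real.pi))⁻¹
  refine lt_of_eq_of_lt (lintegral_congr fun z => ?_) h.lintegral_lt_top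
  rw [Pi.mul_apply, gaussianPDF, ← ENNReal.ofReal_mul (gaussianPDFReal_nonneg _ _ _),
    gaussianPDFReal, mul_assoc, ← Real.exp_add]
  congr 3
  · simp
  · simp
    ring

theorem lintegral_exp_sq_sum_le {ι : Type*} [Fintype ι] {c : ℝ} (hc : 0 ≤ c) (u : ι → ℝ)
    (hu : ∑ i, u i ^ 2 ≤ 1) :
    ∫⁻ g, ENNReal.ofReal (Real.exp (c * (∑ i, g i * u i) ^ 2))
        ∂Measure.pi (fun _ : ι => gaussianReal 0 1)
      ≤ ∫⁻ z, ENNReal.ofReal (Real.exp (c * z ^ 2)) ∂gaussianReal 0 1 := by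
  have hs : Real.sqrt (2 * c) ^ 2 = 2 * c := Real.sq_sqrt (by positivity)
  calc _ = ∫⁻ g, ∫⁻ z, ENNReal.ofReal (Real.exp ((Real.sqrt (2 * c) * ∑ i, g i * u i) * z))
        ∂gaussianReal 0 1 ∂Measure.pi (fun _ : ι => gaussianReal 0 1) := by
        refine lintegral_congr fun g => ?_
        rw [lintegral_exp_mul_gaussianReal, mul_pow, hs]
        congr 2
        push_cast
        ring
    _ = ∫⁻ z, ∫⁻ g, ENNReal.ofReal (Real.exp (∑ i, (Real.sqrt (2 * c) * z * u i) * g i))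
        ∂Measure.pi (fun _ : ι => gaussianReal 0 1) ∂gaussianReal 0 1 := by
        rw [lintegral_lintegral_swap (by fun_prop)]
        refine lintegral_congr fun z => lintegral_congr fun g => ?_
        rw [Finset.mul_sum, Finset.sum_mul]
        congr 2
        exact Finset.sum_congr rfl fun i _ => by ring
    _ ≤ _ := by
        refine lintegral_mono fun z => ?_
        rw [lintegral_exp_sum_mul_pi_gaussianReal]
        refine ENNReal.ofReal_le_ofReal (Real.exp_le_exp.2 ?_)
        simp_rw [mul_pow, hs]
        rw [← Finset.mul_sum]
        have : 0 ≤ c * z ^ 2 := by positivity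
        push_cast
        nlinarith

theorem tendsto_measure_sum_sq_lt {δ : ℝ} (hδ : δ < 1) :
    Tendsto (fun n : ℕ => (Measure.pi fun _ : Fin n => gaussianReal 0 1)
      {g | ∑ i, g i ^ 2 < δ * n}) atTop (𝓝 0) := by
  have hL : MemLp (fun x : ℝ => x ^ 2) 2 (gaussianReal 0 1) := by
    have h := (memLp_id_gaussianReal (μ := 0) (v := 1) 4).integrable_norm_pow (by simp)
    rw [memLp_two_iff_integrable_sq (by fun_prop)]
    refine h.congr (ae_of_all _ fun x => ?_)
    have : |x| ^ 4 = x ^ 4 := Even.pow_abs (by decide) x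
    simp [this, ← pow_mul]
  have h1 : ∫ x, x ^ 2 ∂gaussianReal 0 1 = 1 := by
    have h := variance_fun_id_gaussianReal (μ := 0) (v := 1)
    rw [variance_eq_integral (by fun_prop)] at h
    simpa using h
  set V := Var[fun x : ℝ => x ^ 2; gaussianReal 0 1]
  have hbound : ∀ n : ℕ, 0 < n → (Measure.pi fun _ : Fin n => gaussianReal 0 1)
      {g | ∑ i, g i ^ 2 < δ * n} ≤ ENNReal.ofReal (V / (1 - δ) ^ 2 * (n : ℝ)⁻¹) := by
    intro n hn
    have hn' : (0 : ℝ) < n := by exact_mod_cast hn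
    have hLi (i : Fin n) : MemLp (fun g : Fin n → ℝ => g i ^ 2) 2
        (Measure.pi fun _ : Fin n => gaussianReal 0 1) :=
      hL.comp_measurePreserving (measurePreserving_eval _ i)
    have hmean (i : Fin n) : ∫ g : Fin n → ℝ, g i ^ 2
        ∂(Measure.pi fun _ : Fin n => gaussianReal 0 1) = 1 := by
      have h := integral_map (f := fun x : ℝ => x ^ 2)
        (measurePreserving_eval (fun _ : Fin n => gaussianReal 0 1) i).aemeasurable (by fun_prop)
      rw [(measurePreserving_eval (fun _ : Fin n => gaussianReal 0 1) i).map_eq, h1] at h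
      exact h.symm
    have hvar := variance_sum_pi (μ := fun _ : Fin n => gaussianReal 0 1)
      (X := fun _ x => x ^ 2) fun _ => hL
    have hsum : MemLp (∑ i, fun g : Fin n → ℝ => g i ^ 2) 2
        (Measure.pi fun _ : Fin n => gaussianReal 0 1) := memLp_finsetSum' _ fun i _ => hLi i
    have hint : ∫ g, (∑ i, fun g : Fin n → ℝ => g i ^ 2) g
        ∂(Measure.pi fun _ : Fin n => gaussianReal 0 1) = n := by
      simp_rw [Finset.sum_apply]
      rw [integral_finsetSum _ fun i _ => (hLi i).integrable (by norm_num)]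
      simp [hmean]
    have hcheb := meas_ge_le_variance_div_sq hsum (c := (1 - δ) * n) (by nlinarith)
    rw [hint, hvar] at hcheb
    refine (measure_mono fun g hg => ?_).trans (hcheb.trans_eq ?_)
    · simp only [Set.mem_ofPred_eq, Finset.sum_apply] at hg ⊢
      rw [le_abs]
      right
      linarith
    · simp only [Finset.sum_const, Finset.card_univ, Fintype.card_fin, nsmul_eq_mul]
      congr 1
      have : 1 - δ ≠ 0 := by linarith
      field_simp
      rfl
  have hlim : Tendsto (fun n : ℕ => ENNReal.ofReal (V / (1 - δ) ^ 2 * (n : ℝ)⁻¹)) atTop (𝓝 0) := by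
    have := ENNReal.tendsto_ofReal
      ((tendsto_inv_atTop_nhds_zero_nat (𝕜 := ℝ)).const_mul (V / (1 - δ) ^ 2))
    simpa using this
  exact tendsto_of_tendsto_of_tendsto_of_le_of_le' tendsto_const_nhds hlim
    (.of_forall fun _ => zero_le) ((eventually_gt_atTop 0).mono hbound)

/-- Second moment bound for a mixture of densities, restricted to an event. -/
theorem lintegral_setLIntegral_le_sqrt {T Ω : Type*} [MeasurableSpace T] [MeasurableSpace Ω]
    (τ : Measure T) (μ : Measure Ω) [SFinite τ] [SFinite μ] {L : T → Ω → ℝ≥0∞}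
    (hL : Measurable fun p : T × Ω => L p.1 p.2) {B : Set Ω} (hB : MeasurableSet B) :
    ∫⁻ t, ∫⁻ ω in B, L t ω ∂μ ∂τ
      ≤ μ B ^ (1 / 2 : ℝ)
        * (∫⁻ t, ∫⁻ s, ∫⁻ ω, L t ω * L s ω ∂μ ∂τ ∂τ) ^ (1 / 2 : ℝ) := by
  have hLs : Measurable fun p : Ω × T => L p.2 p.1 := hL.comp measurable_swap
  have hM : Measurable fun ω => ∫⁻ t, L t ω ∂τ := hLs.lintegral_prod_right'
  have hLt (t : T) : Measurable (L t) := hL.comp measurable_prodMk_left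
  have hLω (ω : Ω) : Measurable fun t => L t ω := hL.comp measurable_prodMk_right
  have hsq : ∫⁻ ω, (∫⁻ t, L t ω ∂τ) ^ (2 : ℝ) ∂μ
      = ∫⁻ t, ∫⁻ s, ∫⁻ ω, L t ω * L s ω ∂μ ∂τ ∂τ := by
    calc _ = ∫⁻ ω, ∫⁻ t, L t ω * ∫⁻ s, L s ω ∂τ ∂τ ∂μ := by
          refine lintegral_congr fun ω => ?_
          rw [lintegral_mul_const _ (hLω ω), ENNReal.rpow_two, sq]
      _ = ∫⁻ t, ∫⁻ ω, L t ω * ∫⁻ s, L s ω ∂τ ∂μ ∂τ :=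
          lintegral_lintegral_swap (hLs.mul (hM.comp measurable_fst)).aemeasurable
      _ = ∫⁻ t, ∫⁻ ω, ∫⁻ s, L t ω * L s ω ∂τ ∂μ ∂τ := by
          simp_rw [lintegral_const_mul _ (hLω _)]
      _ = _ := by
          refine lintegral_congr fun t => lintegral_lintegral_swap ?_
          exact (((hLt t).comp measurable_fst).mul hLs).aemeasurable
  have hind : ∫⁻ ω, B.indicator 1 ω ^ (2 : ℝ) ∂μ = μ B := by
    rw [← lintegral_indicator_one hB]
    refine lintegral_congr fun ω => ?_
    by_cases h : ω ∈ B <;> simp [h]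
  rw [lintegral_lintegral_swap hL.aemeasurable, ← hsq, ← hind]
  refine le_of_eq_of_le ?_ (ENNReal.lintegral_mul_le_Lp_mul_Lq μ Real.HolderConjugate.two_two
    (measurable_one.indicator hB).aemeasurable hM.aemeasurable)
  rw [← lintegral_indicator hB]
  refine lintegral_congr fun ω => ?_
  by_cases h : ω ∈ B <;> simp [h]

/-- The radial projection to the unit sphere. -/
noncomputable def sphereProj {n : ℕ} (g : Fin n → ℝ) : Fin n → ℝ :=
  (Real.sqrt (∑ i, g i ^ 2))⁻¹ • g

theorem measurable_sphereProj {n : ℕ} : Measurable (sphereProj (n := n)) := by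
  unfold sphereProj
  fun_prop

theorem sum_sq_sphereProj_le {n : ℕ} (g : Fin n → ℝ) : ∑ i, sphereProj g i ^ 2 ≤ 1 := by
  have h : 0 ≤ ∑ i, g i ^ 2 := Finset.sum_nonneg fun i _ => sq_nonneg _
  simp only [sphereProj, Pi.smul_apply, smul_eq_mul, mul_pow]
  rw [← Finset.mul_sum, inv_pow, Real.sq_sqrt h]
  exact inv_mul_le_one

theorem mul_sq_sum_sphereProj_le {n : ℕ} {δ : ℝ} (hδ : 0 < δ) {g : Fin n → ℝ}
    (hg : δ * n ≤ ∑ i, g i ^ 2) (u : Fin n → ℝ) :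
    n * (∑ i, sphereProj g i * u i) ^ 2 ≤ δ⁻¹ * (∑ i, g i * u i) ^ 2 := by
  have h : 0 ≤ ∑ i, g i ^ 2 := Finset.sum_nonneg fun i _ => sq_nonneg _
  simp only [sphereProj, Pi.smul_apply, smul_eq_mul, mul_assoc]
  rw [← Finset.mul_sum, mul_pow, inv_pow, Real.sq_sqrt h, ← mul_assoc]
  refine mul_le_mul_of_nonneg_right ?_ (sq_nonneg _)
  rcases h.eq_or_lt with h0 | h0
  · rw [← h0]
    simp [hδ.le]
  · rw [← div_eq_mul_inv, div_le_iff₀ h0, inv_mul_eq_div, le_div_iff₀ hδ]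
    linarith

/-- The rank-one shift of the non-symmetrized Gaussian matrix. -/
noncomputable def spikeShift {n : ℕ} (lam : ℝ) (x : Fin n → ℝ) (p : Fin n × Fin n) : ℝ :=
  lam / 2 * (x p.1 * x p.2)

theorem sum_spikeShift_mul {n : ℕ} (lam : ℝ) (x y : Fin n → ℝ) :
    ∑ p, spikeShift lam x p * spikeShift lam y p = lam ^ 2 / 4 * (∑ i, x i * y i) ^ 2 := by
  rw [sq (∑ i, x i * y i), Finset.sum_mul_sum, Fintype.sum_prod_type, Finset.mul_sum]
  refine Finset.sum_congr rfl fun i _ => ?_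
  rw [Finset.mul_sum]
  refine Finset.sum_congr rfl fun j _ => ?_
  simp only [spikeShift]
  ring

/-- The symmetrization map `W ↦ W + Wᵀ`. -/
def symmetrize {n : ℕ} (W : Fin n × Fin n → ℝ) (i j : Fin n) : ℝ := W (i, j) + W (j, i)

theorem measurable_symmetrize {n : ℕ} : Measurable (symmetrize (n := n)) := by
  unfold symmetrize
  fun_prop

theorem gwigUnspiked_eq_map_symmetrize (n : ℕ) :
    gwigUnspiked n = (Measure.pi fun _ : Fin n × Fin n =>
      gaussianReal 0 (1 / (2 * (n : ℝ≥0)))).map symmetrize := rfl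

theorem gwigSpiked_sphericalPrior_apply (n : ℕ) (lam : ℝ) {A : Set (Fin n → Fin n → ℝ)}
    (hA : MeasurableSet A) :
    gwigSpiked n lam (sphericalPrior n) A
      = ∫⁻ g, (Measure.pi fun _ : Fin n × Fin n => gaussianReal 0 (1 / (2 * (n : ℝ≥0)))).map
          (fun W p => W p + spikeShift lam (sphereProj g) p) (symmetrize ⁻¹' A)
        ∂Measure.pi fun _ : Fin n => gaussianReal 0 1 := by
  have : SFinite (gwigUnspiked n) := by
    rw [gwigUnspiked_eq_map_symmetrize]
    infer_instance
  have hf : Measurable fun q : (Fin n → ℝ) × (Fin n → Fin n → ℝ) =>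
      fun i j => lam * (q.1 i * q.1 j) + q.2 i j := by fun_prop
  have hfx (x : Fin n → ℝ) : Measurable fun (Y : Fin n → Fin n → ℝ) =>
      fun i j => lam * (x i * x j) + Y i j := by fun_prop
  have hmeas : Measurable fun x : Fin n → ℝ =>
      (gwigUnspiked n).map fun Y i j => lam * (x i * x j) + Y i j := by
    refine Measure.measurable_of_measurable_coe _ fun s hs => ?_
    simp_rw [Measure.map_apply (hfx _) hs]
    exact measurable_measure_prodMk_left (hf hs)
  rw [gwigSpiked, Measure.bind_apply hA hmeas.aemeasurable, sphericalPrior]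
  refine (lintegral_map ((Measure.measurable_coe hA).comp hmeas) measurable_sphereProj).trans
    (lintegral_congr fun g => ?_)
  change (gwigUnspiked n).map (fun Y i j => lam * (sphereProj g i * sphereProj g j) + Y i j) A = _
  rw [Measure.map_apply (hfx _) hA, gwigUnspiked_eq_map_symmetrize,
    Measure.map_apply measurable_symmetrize (hfx _ hA),
    Measure.map_apply (by fun_prop) (measurable_symmetrize hA)]
  congr 1
  ext W
  simp only [Set.mem_preimage]
  refine iff_of_eq (congrArg (· ∈ A) ?_)
  ext i j
  simp only [symmetrize, spikeShift, sphereProj]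
  ring

theorem lintegral_shiftDensity_sphereProj_le {n : ℕ} (hn : n ≠ 0) (lam : ℝ) {δ : ℝ} (hδ : 0 < δ)
    (h : Fin n → ℝ) :
    ∫⁻ g in {g | ∑ i, g i ^ 2 < δ * n}ᶜ, ∫⁻ W,
        shiftDensity (1 / (2 * (n : ℝ≥0))) (spikeShift lam (sphereProj h)) W
          * shiftDensity (1 / (2 * (n : ℝ≥0))) (spikeShift lam (sphereProj g)) W
        ∂(Measure.pi fun _ : Fin n × Fin n => gaussianReal 0 (1 / (2 * (n : ℝ≥0))))
        ∂(Measure.pi fun _ : Fin n => gaussianReal 0 1)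
      ≤ ∫⁻ z, ENNReal.ofReal (Real.exp (lam ^ 2 / (2 * δ) * z ^ 2)) ∂gaussianReal 0 1 := by
  have hv : 1 / (2 * (n : ℝ≥0)) ≠ 0 := by positivity
  have hS : MeasurableSet {g : Fin n → ℝ | ∑ i, g i ^ 2 < δ * n} :=
    measurableSet_lt (by fun_prop) (by fun_prop)
  simp_rw [lintegral_shiftDensity_mul hv, sum_spikeShift_mul]
  refine (setLIntegral_mono (by fun_prop) fun g hg => ?_).trans ((setLIntegral_le_lintegral _ _).trans
    (lintegral_exp_sq_sum_le (c := lam ^ 2 / (2 * δ)) (by positivity) (sphereProj h)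
      (sum_sq_sphereProj_le h)))
  refine ENNReal.ofReal_le_ofReal (Real.exp_le_exp.2 ?_)
  have hb := mul_sq_sum_sphereProj_le hδ (not_lt.1 hg) (sphereProj h)
  simp_rw [mul_comm (sphereProj h _)]
  have hl : 0 ≤ lam ^ 2 / 2 := by positivity
  have := mul_le_mul_of_nonneg_left hb hl
  push_cast
  calc _ = lam ^ 2 / 2 * (n * (∑ i, sphereProj g i * sphereProj h i) ^ 2) := by
        field_simp
        ring
    _ ≤ _ := this
    _ = _ := by
        field_simp

theorem gwigSpiked_sphericalPrior_le {n : ℕ} (hn : n ≠ 0) (lam : ℝ) {δ : ℝ} (hδ : 0 < δ)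
    {A : Set (Fin n → Fin n → ℝ)} (hA : MeasurableSet A) :
    gwigSpiked n lam (sphericalPrior n) A
      ≤ (Measure.pi fun _ : Fin n => gaussianReal 0 1) {g | ∑ i, g i ^ 2 < δ * n}
        + gwigUnspiked n A ^ (1 / 2 : ℝ)
          * (∫⁻ z, ENNReal.ofReal (Real.exp (lam ^ 2 / (2 * δ) * z ^ 2)) ∂gaussianReal 0 1)
            ^ (1 / 2 : ℝ) := by
  have hv : 1 / (2 * (n : ℝ≥0)) ≠ 0 := by positivity
  have hS : MeasurableSet {g : Fin n → ℝ | ∑ i, g i ^ 2 < δ * n} :=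
    measurableSet_lt (by fun_prop) (by fun_prop)
  have hB := measurable_symmetrize hA
  rw [gwigSpiked_sphericalPrior_apply n lam hA, gwigUnspiked_eq_map_symmetrize,
    Measure.map_apply measurable_symmetrize hA, ← lintegral_add_compl _ hS]
  refine add_le_add ?_ ?_
  · rw [← setLIntegral_one]
    refine setLIntegral_mono measurable_const fun g _ => ?_
    have := Measure.isProbabilityMeasure_map (μ := Measure.pi fun _ : Fin n × Fin n =>
      gaussianReal 0 (1 / (2 * (n : ℝ≥0))))
      (Measurable.aemeasurable (f := fun W p => W p + spikeShift lam (sphereProj g) p)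
        (by fun_prop))
    exact prob_le_one
  · simp_rw [map_add_pi_gaussianReal hv, withDensity_apply _ hB]
    have hL : Measurable fun q : (Fin n → ℝ) × (Fin n × Fin n → ℝ) =>
        shiftDensity (1 / (2 * (n : ℝ≥0))) (spikeShift lam (sphereProj q.1)) q.2 := by
      unfold shiftDensity spikeShift sphereProj
      fun_prop
    refine (lintegral_setLIntegral_le_sqrt
      (L := fun g => shiftDensity (1 / (2 * (n : ℝ≥0))) (spikeShift lam (sphereProj g)))
      _ _ hL hB).trans ?_
    gcongr
    refine (lintegral_mono fun h => lintegral_shiftDensity_sphereProj_le hn lam hδ h).trans ?_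
    rw [lintegral_const]
    exact mul_le_of_le_one_right zero_le ((Measure.restrict_apply_univ _).trans_le prob_le_one)

/-- For the spherical prior and any `0 ≤ λ < 1`, the spiked Gaussian Wigner sequence
is contiguous to the unspiked sequence. -/
theorem stmt_5 (lam : ℝ) (hlam0 : 0 ≤ lam) (hlam1 : lam < 1) :
    Contiguous (fun n => gwigSpiked n lam (sphericalPrior n)) (fun n => gwigUnspiked n) := by
  intro A hA hQ
  obtain ⟨δ, hδl, hδ1⟩ : ∃ δ, lam ^ 2 < δ ∧ δ < 1 :=
    exists_between (by nlinarith)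
  have hδ : 0 < δ := (sq_nonneg lam).trans_lt hδl
  have hC := lintegral_exp_sq_gaussianReal_lt_top (c := lam ^ 2 / (2 * δ)) (by
    rw [div_lt_div_iff₀ (by positivity) (by norm_num)]
    linarith)
  set C := ∫⁻ z, ENNReal.ofReal (Real.exp (lam ^ 2 / (2 * δ) * z ^ 2)) ∂gaussianReal 0 1
  have hsqrt : Tendsto (fun n => gwigUnspiked n (A n) ^ (1 / 2 : ℝ)) atTop (𝓝 0) := by
    have h := ((ENNReal.continuous_rpow_const (y := 1 / 2)).tendsto 0).comp hQ
    rwa [ENNReal.zero_rpow_of_pos (by norm_num)] at h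
  have hlim := (tendsto_measure_sum_sq_lt hδ1).add (ENNReal.Tendsto.mul_const hsqrt
    (.inr (ENNReal.rpow_ne_top_of_nonneg (y := 1 / 2) (by norm_num) hC.ne)))
  rw [zero_mul, add_zero] at hlim
  exact tendsto_of_tendsto_of_tendsto_of_le_of_le' tendsto_const_nhds hlim
    (.of_forall fun _ => zero_le)
    ((eventually_ne_atTop 0).mono fun n hn => gwigSpiked_sphericalPrior_le hn lam hδ (hA n))
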